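/- Let x : D → ℝ⁴ be a smooth minimal time-like surface in canonical coordinates with parameters (ε₀,ε₁) ∈ {(1,0), (−1,0), (0,1)}. If ε₁ = 0 (first or second type) then at every point K² − ϰ² = 1/E⁴ and E = −(K² − ϰ²)^{−1/4}; if (ε₀,ε₁) = (0,1) (third type) then at every point ϰ² − K² = 1/E⁴ and E = −(ϰ² − K²)^{−1/4}. -/

import Mathlib

noncomputable section

abbrev V4 : Type := Fin 4 → ℝ

/-- The indefinite scalar product of `ℝ⁴₂`. -/
def ip (a b : V4) : ℝ := -(a 0 * b 0) + a 1 * b 1 - a 2 * b 2 + a 3 * b 3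

/-- Partial derivative w.r.t. the first variable. -/
def pu {E : Type*} [NormedAddCommGroup E] [NormedSpace ℝ E]
    (f : ℝ × ℝ → E) (p : ℝ × ℝ) : E := fderiv ℝ f p (1, 0)

/-- Partial derivative w.r.t. the second variable. -/
def pv {E : Type*} [NormedAddCommGroup E] [NormedSpace ℝ E]
    (f : ℝ × ℝ → E) (p : ℝ × ℝ) : E := fderiv ℝ f p (0, 1)

/-- `E`, the first coefficient of the first fundamental form. -/
def Ef (x : ℝ × ℝ → V4) (p : ℝ × ℝ) : ℝ := ip (pu x p) (pu x p)

/-- Normal projection of a vector `w` at the point `p` of the surface `x`: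
`w^⊥ = w − (⟨w,x_u⟩/E)·x_u + (⟨w,x_v⟩/E)·x_v`. -/
def nproj (x : ℝ × ℝ → V4) (w : V4) (p : ℝ × ℝ) : V4 :=
  w - (ip w (pu x p) / Ef x p) • pu x p + (ip w (pv x p) / Ef x p) • pv x p

/-- `a = (x_uu)^⊥`. -/
def sffA (x : ℝ × ℝ → V4) (p : ℝ × ℝ) : V4 := nproj x (pu (pu x) p) p

/-- `b = (x_uv)^⊥`. -/
def sffB (x : ℝ × ℝ → V4) (p : ℝ × ℝ) : V4 := nproj x (pv (pu x) p) p

/-- Determinant of the 4×4 matrix with columns `v1, v2, v3, v4`. -/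
def det4 (v1 v2 v3 v4 : V4) : ℝ := (Matrix.of ![v1, v2, v3, v4]).transpose.det

/-- The Gauss curvature `K = (⟨b,b⟩ − ⟨a,a⟩)/E²`. -/
def GaussK (x : ℝ × ℝ → V4) (p : ℝ × ℝ) : ℝ :=
  (ip (sffB x p) (sffB x p) - ip (sffA x p) (sffA x p)) / (Ef x p) ^ 2

/-- The curvature of the normal connection `ϰ = −2·det[x_u,x_v,a,b]/E³`. -/
def NormK (x : ℝ × ℝ → V4) (p : ℝ × ℝ) : ℝ :=
  -2 * det4 (pu x p) (pv x p) (sffA x p) (sffB x p) / (Ef x p) ^ 3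

/-- The hyperbolic Laplacian `Δʰ f = f_uu − f_vv`. -/
def hlap (f : ℝ × ℝ → ℝ) (p : ℝ × ℝ) : ℝ := pu (pu f) p - pv (pv f) p

/-- Time-like surface in isothermal coordinates with `E < 0`. -/
def IsTimelikeIso (D : Set (ℝ × ℝ)) (x : ℝ × ℝ → V4) : Prop :=
  ∀ p ∈ D, Ef x p < 0 ∧ ip (pv x p) (pv x p) = -(Ef x p) ∧ ip (pu x p) (pv x p) = 0

/-- Minimality: `x_uu − x_vv = 0`. -/
def IsMinimal (D : Set (ℝ × ℝ)) (x : ℝ × ℝ → V4) : Prop :=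
  ∀ p ∈ D, pu (pu x) p - pv (pv x) p = 0

/-- Degenerate point: `(⟨a,a⟩+⟨b,b⟩)² = 4⟨a,b⟩²`. -/
def DegeneratePt (x : ℝ × ℝ → V4) (p : ℝ × ℝ) : Prop :=
  (ip (sffA x p) (sffA x p) + ip (sffB x p) (sffB x p)) ^ 2 =
    4 * (ip (sffA x p) (sffB x p)) ^ 2

/-- Surface of the first type. -/
def FirstType (D : Set (ℝ × ℝ)) (x : ℝ × ℝ → V4) : Prop :=
  ∀ p ∈ D,
    (ip (sffA x p) (sffA x p) + ip (sffB x p) (sffB x p)) ^ 2 -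
      4 * (ip (sffA x p) (sffB x p)) ^ 2 > 0 ∧
    ip (sffA x p) (sffA x p) + ip (sffB x p) (sffB x p) > 0

/-- Surface of the second type. -/
def SecondType (D : Set (ℝ × ℝ)) (x : ℝ × ℝ → V4) : Prop :=
  ∀ p ∈ D,
    (ip (sffA x p) (sffA x p) + ip (sffB x p) (sffB x p)) ^ 2 -
      4 * (ip (sffA x p) (sffB x p)) ^ 2 > 0 ∧
    ip (sffA x p) (sffA x p) + ip (sffB x p) (sffB x p) < 0

/-- Surface of the third type. -/
def ThirdType (D : Set (ℝ × ℝ)) (x : ℝ × ℝ → V4) : Prop :=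
  ∀ p ∈ D,
    (ip (sffA x p) (sffA x p) + ip (sffB x p) (sffB x p)) ^ 2 -
      4 * (ip (sffA x p) (sffB x p)) ^ 2 < 0

/-- Canonical coordinates with parameters `(e0, e1)`:
`⟨a,a⟩+⟨b,b⟩ = e0` and `2⟨a,b⟩ = e1` identically. -/
def Canonical (D : Set (ℝ × ℝ)) (x : ℝ × ℝ → V4) (e0 e1 : ℝ) : Prop :=
  ∀ p ∈ D,
    ip (sffA x p) (sffA x p) + ip (sffB x p) (sffB x p) = e0 ∧
    2 * ip (sffA x p) (sffB x p) = e1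

/-- The Gram determinant formula for vectors whose mutual products between the pairs `(u, v)` and
`(a, b)` vanish, with `u`, `v` orthogonal. -/
theorem det4_sq_of_orthogonal (u v a b : V4) (huv : ip u v = 0) (hau : ip a u = 0)
    (hav : ip a v = 0) (hbu : ip b u = 0) (hbv : ip b v = 0) :
    det4 u v a b ^ 2 = ip u u * ip v v * (ip a a * ip b b - ip a b ^ 2) := by
  let M : Matrix (Fin 4) (Fin 4) ℝ := Matrix.of ![u, v, a, b]
  let J : Matrix (Fin 4) (Fin 4) ℝ := Matrix.diagonal ![-1, 1, -1, 1]
  have hJ : J.det = 1 := by simp [J, Matrix.det_diagonal, Fin.prod_univ_four]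
  have hG : M * J * M.transpose =
      !![ip u u, 0, 0, 0; 0, ip v v, 0, 0; 0, 0, ip a a, ip a b; 0, 0, ip a b, ip b b] := by
    unfold ip at *
    ext i j
    rw [Matrix.mul_apply]
    fin_cases i <;> fin_cases j <;>
      simp [M, J, Matrix.mul_diagonal, Fin.sum_univ_four] <;> linarith
  have hdet : (M * J * M.transpose).det = det4 u v a b ^ 2 := by
    rw [Matrix.det_mul, Matrix.det_mul, hJ, det4, Matrix.det_transpose]
    ring
  rw [← hdet, hG]
  simp [Matrix.det_succ_row_zero, Fin.sum_univ_succ, Fin.succAbove]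
  ring

theorem ip_comb (w u v z : V4) (s t : ℝ) :
    ip (w - s • u + t • v) z = ip w z - s * ip u z + t * ip v z := by
  simp only [ip, Pi.add_apply, Pi.sub_apply, Pi.smul_apply, smul_eq_mul]
  ring

theorem ip_comm (a b : V4) : ip a b = ip b a := by
  simp only [ip]
  ring

theorem ip_nproj_pu {x : ℝ × ℝ → V4} {p : ℝ × ℝ} (hE : Ef x p ≠ 0)
    (huv : ip (pu x p) (pv x p) = 0) (w : V4) : ip (nproj x w p) (pu x p) = 0 := by
  rw [nproj, ip_comb, ip_comm (pv x p), huv, ← Ef]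
  field_simp
  ring

theorem ip_nproj_pv {x : ℝ × ℝ → V4} {p : ℝ × ℝ} (hE : Ef x p ≠ 0)
    (hvv : ip (pv x p) (pv x p) = -Ef x p) (huv : ip (pu x p) (pv x p) = 0) (w : V4) :
    ip (nproj x w p) (pv x p) = 0 := by
  rw [nproj, ip_comb, huv, hvv]
  field_simp
  ring

/-- The invariant form of `K² − ϰ²` in isothermal coordinates. -/
theorem GaussK_sq_sub_NormK_sq {x : ℝ × ℝ → V4} {p : ℝ × ℝ} (hE : Ef x p ≠ 0)
    (hvv : ip (pv x p) (pv x p) = -Ef x p) (huv : ip (pu x p) (pv x p) = 0) :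
    GaussK x p ^ 2 - NormK x p ^ 2 =
      ((ip (sffA x p) (sffA x p) + ip (sffB x p) (sffB x p)) ^ 2 -
        (2 * ip (sffA x p) (sffB x p)) ^ 2) / Ef x p ^ 4 := by
  have hdet := det4_sq_of_orthogonal (pu x p) (pv x p) (sffA x p) (sffB x p) huv
    (ip_nproj_pu hE huv _) (ip_nproj_pv hE hvv huv _)
    (ip_nproj_pu hE huv _) (ip_nproj_pv hE hvv huv _)
  rw [hvv, ← Ef] at hdet
  rw [GaussK, NormK, div_pow, div_pow, mul_pow, hdet]
  field_simp
  ring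

theorem eq_neg_rpow_of_neg {E : ℝ} (hE : E < 0) : E = -((1 / E ^ 4) ^ (-(1 / 4 : ℝ))) := by
  have h : 1 / E ^ 4 = (-E) ^ (-4 : ℝ) := by
    rw [Real.rpow_neg (by linarith), one_div, show (4 : ℝ) = (4 : ℕ) by norm_num,
      Real.rpow_natCast, Even.neg_pow (by decide)]
  rw [h, ← Real.rpow_mul (by linarith)]
  norm_num

/-- In canonical coordinates, `K² − ϰ² = 1/E⁴` and
`E = −(K² − ϰ²)^(−1/4)` for the first and second type (`ε₁ = 0`), while
`ϰ² − K² = 1/E⁴` and `E = −(ϰ² − K²)^(−1/4)` for the third type (`(ε₀,ε₁) = (0,1)`). -/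
theorem stmt_12 (D : Set (ℝ × ℝ)) (hD : IsOpen D) (x : ℝ × ℝ → V4)
    (hx : ContDiffOn ℝ (⊤ : ℕ∞) x D) (hiso : IsTimelikeIso D x) (hmin : IsMinimal D x)
    (e0 e1 : ℝ)
    (hpar : (e0, e1) = (1, 0) ∨ (e0, e1) = (-1, 0) ∨ (e0, e1) = (0, 1))
    (hcan : Canonical D x e0 e1) :
    (e1 = 0 → ∀ p ∈ D,
      GaussK x p ^ 2 - NormK x p ^ 2 = 1 / (Ef x p) ^ 4 ∧
      Ef x p = -((GaussK x p ^ 2 - NormK x p ^ 2) ^ (-(1 / 4 : ℝ)))) ∧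
    ((e0 = 0 ∧ e1 = 1) → ∀ p ∈ D,
      NormK x p ^ 2 - GaussK x p ^ 2 = 1 / (Ef x p) ^ 4 ∧
      Ef x p = -((NormK x p ^ 2 - GaussK x p ^ 2) ^ (-(1 / 4 : ℝ)))) := by
  refine ⟨fun h1 p hp => ?_, fun h01 p hp => ?_⟩ <;>
    obtain ⟨hE, hvv, huv⟩ := hiso p hp <;>
    have hK := GaussK_sq_sub_NormK_sq hE.ne hvv huv <;>
    rw [(hcan p hp).1, (hcan p hp).2] at hK
  · have h0 : e0 ^ 2 = 1 := by
      simp only [Prod.mk.injEq] at hpar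
      rcases hpar with h | h | h
      · simp [h.1]
      · simp [h.1]
      · exact absurd (h1.symm.trans h.2) zero_ne_one
    have h : GaussK x p ^ 2 - NormK x p ^ 2 = 1 / Ef x p ^ 4 := by
      rw [hK, h0, h1]
      norm_num
    exact ⟨h, h ▸ eq_neg_rpow_of_neg hE⟩
  · have h : NormK x p ^ 2 - GaussK x p ^ 2 = 1 / Ef x p ^ 4 := by
      rw [← neg_sub, hK, h01.1, h01.2]
      ring
    exact ⟨h, h ▸ eq_neg_rpow_of_neg hE⟩
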